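/- Let ℓ > 0 and let α ∈ (−∞, −2) ∪ (1, 2). For each energy h such that the equation h + r^(−α)/α − ℓ²/(2r²) = 0 has exactly two positive solutions r₋ < r₊, define the apsidal angle Θ_α(h) = ∫_{r₋}^{r₊} ℓ / (r² √(2(h + r^(−α)/α) − ℓ²/r²)) dr. Then Θ_α is a strictly increasing function of h on the set of such admissible energies. -/

import Mathlib

/-- The radial apsis equation `h + r^(-α)/α - ℓ²/(2r²) = 0` has exactly the two
positive solutions `rlo < rhi`. -/
def IsTwoApsidal (α ℓ h rlo rhi : ℝ) : Prop :=
  0 < rlo ∧ rlo < rhi ∧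
    h + rlo ^ (-α) / α - ℓ ^ 2 / (2 * rlo ^ 2) = 0 ∧
    h + rhi ^ (-α) / α - ℓ ^ 2 / (2 * rhi ^ 2) = 0 ∧
    ∀ r : ℝ, 0 < r → h + r ^ (-α) / α - ℓ ^ 2 / (2 * r ^ 2) = 0 → r = rlo ∨ r = rhi

/-- The apsidal angle at energy `h`, integrated between the apsidal radii `a < b`. -/
noncomputable def apsidalAngle (α ℓ h a b : ℝ) : ℝ :=
  ∫ r in a..b, ℓ / (r ^ 2 * Real.sqrt (2 * (h + r ^ (-α) / α) - ℓ ^ 2 / r ^ 2))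


open Set MeasureTheory

/-- The potential well `s ^ 2 / 2 - s ^ (m + 1) / (m + 1)`, shifted to vanish at its minimum `1`. -/
noncomputable def pot (m s : ℝ) : ℝ := s ^ 2 / 2 - s * s ^ m / (m + 1) + (1 / (m + 1) - 1 / 2)
/-- The derivative of `pot m`. -/
noncomputable def potDeriv (m s : ℝ) : ℝ := s - s ^ m
/-- The second derivative of `pot m`. -/
noncomputable def potDeriv₂ (m s : ℝ) : ℝ := 1 - m * (s ^ m / s)

lemma hasDerivAt_rpow_div {m s : ℝ} (hs : 0 < s) :
    HasDerivAt (fun x : ℝ => x ^ m) (m * (s ^ m / s)) s := by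
  have := Real.hasDerivAt_rpow_const (x := s) (p := m) (Or.inl hs.ne')
  rwa [Real.rpow_sub_one hs.ne'] at this

lemma hasDerivAt_pot {m s : ℝ} (hm : 0 < m) (hs : 0 < s) :
    HasDerivAt (pot m) (potDeriv m s) s := by
  have hX := hasDerivAt_rpow_div (m := m) hs
  have := ((((hasDerivAt_id s).pow 2).div_const 2).sub
    (((hasDerivAt_id s).mul hX).div_const (m + 1))).add_const (1 / (m + 1) - 1 / 2)
  refine (this.congr_deriv ?_)
  have hm' : m + 1 ≠ 0 := by positivity
  simp only [potDeriv, id]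
  field_simp
  push_cast
  ring

lemma hasDerivAt_potDeriv {m s : ℝ} (hs : 0 < s) :
    HasDerivAt (potDeriv m) (potDeriv₂ m s) s :=
  (hasDerivAt_id s).sub (hasDerivAt_rpow_div (m := m) hs)

lemma hasDerivAt_potDeriv₂ {m s : ℝ} (hs : 0 < s) :
    HasDerivAt (potDeriv₂ m) (m * (1 - m) * (s ^ m / s ^ 2)) s := by
  have := (((hasDerivAt_rpow_div (m := m) hs).div (hasDerivAt_id s) hs.ne').const_mul m).const_sub 1
  refine this.congr_deriv ?_
  simp only [id]
  field_simp
  ring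

lemma pot_one (m : ℝ) : pot m 1 = 0 := by simp [pot]
lemma potDeriv_one (m : ℝ) : potDeriv m 1 = 0 := by simp [potDeriv]

lemma potDeriv_pos {m s : ℝ} (hm1 : m < 1) (hs : 1 < s) : 0 < potDeriv m s := by
  have := Real.rpow_lt_rpow_of_exponent_lt hs hm1
  rw [Real.rpow_one] at this
  exact sub_pos.2 this

lemma potDeriv_neg {m s : ℝ} (hm1 : m < 1) (hs0 : 0 < s) (hs : s < 1) : potDeriv m s < 0 := by
  have := Real.rpow_lt_rpow_of_exponent_gt hs0 hs hm1
  rw [Real.rpow_one] at this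
  exact sub_neg.2 this

/-- A tangent-line bound for `s ^ m` at `exp (-2)`. -/
lemma tangent_bound {m s : ℝ} (hm : 0 < m) (hm1 : m < 1) (hs : 0 < s) :
    0 < (2 * m + 1) * (s - m * s ^ m) + (2 - m) * (1 - m) := by
  have hb : (s * Real.exp 2) ^ m ≤ 1 + m * (s * Real.exp 2 - 1) := by
    have := rpow_one_add_le_one_add_mul_self (s := s * Real.exp 2 - 1) (p := m)
      (by have := Real.exp_pos 2; nlinarith) hm.le hm1.le
    simpa using this
  rw [Real.mul_rpow hs.le (Real.exp_pos 2).le, ← Real.exp_mul] at hb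
  have e1 : 1 + 2 * m ≤ Real.exp (2 * m) := by
    have := Real.add_one_le_exp (2 * m); linarith
  have e2 : m ^ 2 * Real.exp 2 ≤ Real.exp (2 * m) := by
    have h1 : m ≤ Real.exp (m - 1) := by
      have := Real.add_one_le_exp (m - 1); linarith
    have h2 : m ^ 2 ≤ Real.exp (m - 1) ^ 2 := pow_le_pow_left₀ hm.le h1 2
    have h3 : Real.exp (2 * m) = Real.exp (m - 1) ^ 2 * Real.exp 2 := by
      rw [← Real.exp_nat_mul, ← Real.exp_add]; congr 1; push_cast; ring
    rw [h3]
    exact mul_le_mul_of_nonneg_right h2 (Real.exp_pos 2).le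
  set Y := Real.exp (2 * m)
  have hY : 0 < Y := Real.exp_pos _
  have h4 : m * (s ^ m * Y) ≤ m * (1 - m) + Y * s := by
    nlinarith [mul_le_mul_of_nonneg_left e2 hs.le, mul_le_mul_of_nonneg_left hb hm.le]
  have h5 : 0 < Y * ((2 * m + 1) * (s - m * s ^ m) + (2 - m) * (1 - m)) := by
    have h6 : (2 * m + 1) * (m * (s ^ m * Y)) ≤ (2 * m + 1) * (m * (1 - m) + Y * s) :=
      mul_le_mul_of_nonneg_left h4 (by positivity)
    have h7 : (1 + 2 * m) * ((2 - m) * (1 - m)) ≤ Y * ((2 - m) * (1 - m)) :=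
      mul_le_mul_of_nonneg_right e1 (mul_nonneg (by linarith) (by linarith))
    have h8 : 0 < (2 * m + 1) * (1 - m) * (1 - m) :=
      mul_pos (mul_pos (by linarith) (by linarith)) (by linarith)
    nlinarith
  exact pos_of_mul_pos_right h5 hY.le

lemma strictMonoOn_of_hasDerivAt_pos {f f' : ℝ → ℝ} {S : Set ℝ} (hc : Convex ℝ S)
    (hf : ∀ s ∈ S, HasDerivAt f (f' s) s) (hpos : ∀ s ∈ interior S, 0 < f' s) :
    StrictMonoOn f S :=
  strictMonoOn_of_deriv_pos hc (fun s hs => (hf s hs).continuousAt.continuousWithinAt)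
    fun s hs => by rw [(hf s (interior_subset hs)).deriv]; exact hpos s hs

lemma strictAntiOn_of_hasDerivAt_neg {f f' : ℝ → ℝ} {S : Set ℝ} (hc : Convex ℝ S)
    (hf : ∀ s ∈ S, HasDerivAt f (f' s) s) (hneg : ∀ s ∈ interior S, f' s < 0) :
    StrictAntiOn f S :=
  strictAntiOn_of_deriv_neg hc (fun s hs => (hf s hs).continuousAt.continuousWithinAt)
    fun s hs => by rw [(hf s (interior_subset hs)).deriv]; exact hneg s hs

/-- The sign of `auxQ` off `1` is that of the derivative of `auxH` divided by `potDeriv`. -/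
noncomputable def auxQ (m s : ℝ) : ℝ :=
  (4 - m) - (4 * m + 2) * (s ^ m / s) + m * (2 * m + 1) * (s ^ m / s) ^ 2
    - 2 * (1 - m) ^ 2 * (s ^ m / s ^ 2)

lemma auxQ_strictMonoOn {m : ℝ} (hm : 0 < m) (hm1 : m < 1) : StrictMonoOn (auxQ m) (Ioi 0) := by
  refine strictMonoOn_of_hasDerivAt_pos (convex_Ioi 0)
    (f' := fun s => 2 * (1 - m) * (s ^ m / s ^ 3) *
      ((2 * m + 1) * (s - m * s ^ m) + (2 - m) * (1 - m))) ?_ ?_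
  · intro s hs
    have hs : 0 < s := hs
    have hX := hasDerivAt_rpow_div (m := m) hs
    have h1 := hX.div (hasDerivAt_id s) hs.ne'
    have h2 := hX.div ((hasDerivAt_id s).pow 2) (by simp [hs.ne'])
    have := (((h1.const_mul (4 * m + 2)).const_sub (4 - m)).add
      ((h1.pow 2).const_mul (m * (2 * m + 1)))).sub (h2.const_mul (2 * (1 - m) ^ 2))
    refine this.congr_deriv ?_
    simp only [id, Pi.div_apply, Pi.pow_apply]
    generalize s ^ m = X
    push_cast
    simp only [pow_one]
    field_simp
    ring
  · intro s hs
    rw [interior_Ioi] at hs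
    have hs : 0 < s := hs
    have := Real.rpow_pos_of_pos hs m
    have h1 : 0 < 1 - m := by linarith
    have := tangent_bound hm hm1 hs
    positivity

lemma auxQ_one (m : ℝ) : auxQ m 1 = 0 := by simp [auxQ]; ring

/-- The derivative of `auxD` is a positive multiple of `auxH`. -/
noncomputable def auxH (m s : ℝ) : ℝ :=
  potDeriv m s ^ 2 * potDeriv₂ m s * (s ^ 2 / s ^ m) - 2 * (1 - m) ^ 2 * pot m s

lemma hasDerivAt_auxH {m s : ℝ} (hm : 0 < m) (hs : 0 < s) :
    HasDerivAt (auxH m) (potDeriv m s * (s ^ 2 / s ^ m) * auxQ m s) s := by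
  have hX := hasDerivAt_rpow_div (m := m) hs
  have hp := Real.rpow_pos_of_pos hs m
  have := ((((hasDerivAt_potDeriv (m := m) hs).pow 2).mul (hasDerivAt_potDeriv₂ (m := m) hs)).mul
    (((hasDerivAt_id s).pow 2).div hX hp.ne')).sub
      ((hasDerivAt_pot hm hs).const_mul (2 * (1 - m) ^ 2))
  refine this.congr_deriv ?_
  simp only [id, Pi.div_apply, Pi.pow_apply, Pi.mul_apply, auxQ, potDeriv, potDeriv₂]
  generalize s ^ m = X at *
  field_simp
  push_cast
  ring

lemma auxH_one (m : ℝ) : auxH m 1 = 0 := by simp [auxH, pot_one, potDeriv_one]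

lemma auxH_pos {m s : ℝ} (hm : 0 < m) (hm1 : m < 1) (hs : 1 < s) : 0 < auxH m s := by
  have : StrictMonoOn (auxH m) (Ici 1) := by
    refine strictMonoOn_of_hasDerivAt_pos (convex_Ici 1)
      (fun s hs => hasDerivAt_auxH hm (lt_of_lt_of_le one_pos hs)) fun s hs => ?_
    rw [interior_Ici] at hs
    have hs : 1 < s := hs
    have hs0 : 0 < s := by linarith
    have h1 := auxQ_strictMonoOn hm hm1 (mem_Ioi.2 one_pos) hs0 hs
    rw [auxQ_one] at h1
    have := potDeriv_pos hm1 hs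
    have := Real.rpow_pos_of_pos hs0 m
    positivity
  simpa [auxH_one] using this (mem_Ici.2 le_rfl) hs.le hs

lemma auxH_neg {m s : ℝ} (hm : 0 < m) (hm1 : m < 1) (hs0 : 0 < s) (hs : s < 1) :
    auxH m s < 0 := by
  have : StrictMonoOn (auxH m) (Ioc 0 1) := by
    refine strictMonoOn_of_hasDerivAt_pos (convex_Ioc 0 1)
      (fun s hs => hasDerivAt_auxH hm hs.1) fun s hs => ?_
    rw [interior_Ioc] at hs
    have h1 := auxQ_strictMonoOn hm hm1 hs.1 (mem_Ioi.2 one_pos) hs.2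
    rw [auxQ_one] at h1
    have h2 := potDeriv_neg hm1 hs.1 hs.2
    have h3 := Real.rpow_pos_of_pos hs.1 m
    have h4 : 0 < s ^ 2 / s ^ m := by have := hs.1; positivity
    exact mul_pos_of_neg_of_neg (mul_neg_of_neg_of_pos h2 h4) h1
  simpa [auxH_one] using this ⟨hs0, hs.le⟩ ⟨one_pos, le_rfl⟩ hs

/-- The derivative of `auxA` is a positive multiple of `auxD`. -/
noncomputable def auxD (m s : ℝ) : ℝ :=
  potDeriv m s ^ 2 + m / (3 * (1 - m)) * potDeriv m s ^ 3 - 2 * pot m s * potDeriv₂ m s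

lemma hasDerivAt_auxD {m s : ℝ} (hm : 0 < m) (hm1 : m < 1) (hs : 0 < s) :
    HasDerivAt (auxD m) (m / (1 - m) * (s ^ m / s ^ 2) * auxH m s) s := by
  have hp := Real.rpow_pos_of_pos hs m
  have h1 := hasDerivAt_potDeriv (m := m) hs
  have h1m : 1 - m ≠ 0 := by linarith
  have := ((h1.pow 2).add ((h1.pow 3).const_mul (m / (3 * (1 - m))))).sub
    (((hasDerivAt_pot hm hs).const_mul 2).mul (hasDerivAt_potDeriv₂ (m := m) hs))
  refine this.congr_deriv ?_
  simp only [auxH]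
  generalize pot m s = W
  generalize potDeriv m s = V
  generalize potDeriv₂ m s = U
  generalize s ^ m = X at *
  field_simp
  push_cast
  ring

lemma auxD_one (m : ℝ) : auxD m 1 = 0 := by simp [auxD, pot_one, potDeriv_one]

lemma auxD_pos {m s : ℝ} (hm : 0 < m) (hm1 : m < 1) (hs0 : 0 < s) (hs : s ≠ 1) :
    0 < auxD m s := by
  have h1m : 0 < 1 - m := by linarith
  rcases hs.lt_or_gt with h | h
  · have : StrictAntiOn (auxD m) (Ioc 0 1) := by
      refine strictAntiOn_of_hasDerivAt_neg (convex_Ioc 0 1)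
        (fun s hs => hasDerivAt_auxD hm hm1 hs.1) fun s hs => ?_
      rw [interior_Ioc] at hs
      have h3 := Real.rpow_pos_of_pos hs.1 m
      have := hs.1
      exact mul_neg_of_pos_of_neg (by positivity) (auxH_neg hm hm1 hs.1 hs.2)
    simpa [auxD_one] using this ⟨hs0, h.le⟩ ⟨one_pos, le_rfl⟩ h
  · have : StrictMonoOn (auxD m) (Ici 1) := by
      refine strictMonoOn_of_hasDerivAt_pos (convex_Ici 1)
        (fun s hs => hasDerivAt_auxD hm hm1 (lt_of_lt_of_le one_pos hs)) fun s hs => ?_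
      rw [interior_Ici] at hs
      have hs : 1 < s := hs
      have hs0 : 0 < s := by linarith
      have := Real.rpow_pos_of_pos hs0 m
      have := auxH_pos hm hm1 hs
      positivity
    simpa [auxD_one] using this (mem_Ici.2 le_rfl) h.le h

lemma pot_strictMonoOn {m : ℝ} (hm : 0 < m) (hm1 : m < 1) : StrictMonoOn (pot m) (Ici 1) := by
  refine strictMonoOn_of_hasDerivAt_pos (convex_Ici 1)
    (fun s hs => hasDerivAt_pot hm (lt_of_lt_of_le one_pos hs)) fun s hs => ?_
  rw [interior_Ici] at hs
  exact potDeriv_pos hm1 hs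

lemma pot_strictAntiOn {m : ℝ} (hm : 0 < m) (hm1 : m < 1) : StrictAntiOn (pot m) (Ioc 0 1) := by
  refine strictAntiOn_of_hasDerivAt_neg (convex_Ioc 0 1)
    (fun s hs => hasDerivAt_pot hm hs.1) fun s hs => ?_
  rw [interior_Ioc] at hs
  exact potDeriv_neg hm1 hs.1 hs.2

lemma pot_pos {m s : ℝ} (hm : 0 < m) (hm1 : m < 1) (hs0 : 0 < s) (hs : s ≠ 1) : 0 < pot m s := by
  rw [← pot_one m]
  rcases hs.lt_or_gt with h | h
  · exact pot_strictAntiOn hm hm1 ⟨hs0, h.le⟩ ⟨one_pos, le_rfl⟩ h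
  · exact pot_strictMonoOn hm hm1 (mem_Ici.2 le_rfl) h.le h

/-- `√V / V'` for `V = pot m`, corrected by a multiple of `√V` so as to be strictly increasing on
both sides of the minimum. -/
noncomputable def auxA (m s : ℝ) : ℝ :=
  √(pot m s) * (1 / potDeriv m s + m / (3 * (1 - m)))

lemma potDeriv_ne_zero {m s : ℝ} (hm1 : m < 1) (hs0 : 0 < s) (hs : s ≠ 1) :
    potDeriv m s ≠ 0 := by
  rcases hs.lt_or_gt with h | h
  · exact (potDeriv_neg hm1 hs0 h).ne
  · exact (potDeriv_pos hm1 h).ne'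

lemma hasDerivAt_auxA {m s : ℝ} (hm : 0 < m) (hm1 : m < 1) (hs0 : 0 < s) (hs : s ≠ 1) :
    HasDerivAt (auxA m) (auxD m s / (2 * √(pot m s) * potDeriv m s ^ 2)) s := by
  have hW := pot_pos hm hm1 hs0 hs
  have hV := potDeriv_ne_zero hm1 hs0 hs
  have := ((hasDerivAt_pot hm hs0).sqrt hW.ne').mul
    (((hasDerivAt_potDeriv (m := m) hs0).inv hV).add_const (m / (3 * (1 - m))))
  have h2 : auxA m = (fun y => √(pot m y)) * fun x => (potDeriv m)⁻¹ x + m / (3 * (1 - m)) := by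
    ext x; simp [auxA]
  rw [h2]
  refine this.congr_deriv ?_
  simp only [auxD, Pi.inv_apply]
  have hsq : √(pot m s) ^ 2 = pot m s := Real.sq_sqrt hW.le
  have hR := (Real.sqrt_pos.2 hW).ne'
  set R := √(pot m s)
  rw [← hsq]
  generalize potDeriv m s = V at *
  generalize m / (3 * (1 - m)) = κ
  field_simp
  ring

lemma auxA_strictMonoOn_Ioi {m : ℝ} (hm : 0 < m) (hm1 : m < 1) :
    StrictMonoOn (auxA m) (Ioi 1) := by
  refine strictMonoOn_of_hasDerivAt_pos (convex_Ioi 1)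
    (fun s hs => hasDerivAt_auxA hm hm1 (one_pos.trans hs) (ne_of_gt hs)) fun s hs => ?_
  rw [interior_Ioi] at hs
  have h0 : 0 < s := one_pos.trans hs
  have h1 : s ≠ 1 := ne_of_gt hs
  have := auxD_pos hm hm1 h0 h1
  have := pot_pos hm hm1 h0 h1
  have := potDeriv_ne_zero hm1 h0 h1
  positivity

lemma auxA_strictMonoOn_Ioo {m : ℝ} (hm : 0 < m) (hm1 : m < 1) :
    StrictMonoOn (auxA m) (Ioo 0 1) := by
  refine strictMonoOn_of_hasDerivAt_pos (convex_Ioo 0 1)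
    (fun s hs => hasDerivAt_auxA hm hm1 hs.1 hs.2.ne) fun s hs => ?_
  rw [interior_Ioo] at hs
  have := auxD_pos hm hm1 hs.1 hs.2.ne
  have := pot_pos hm hm1 hs.1 hs.2.ne
  have := potDeriv_ne_zero hm1 hs.1 hs.2.ne
  positivity

lemma integrableOn_arcsine_density :
    IntegrableOn (fun t : ℝ => 1 / √(2 * (t * (1 - t)))) (Ioo 0 1) := by
  have hd : ∀ t ∈ Ioo (0 : ℝ) 1, HasDerivAt (fun t : ℝ => Real.arcsin (2 * t - 1) / √2)
      (1 / √(2 * (t * (1 - t)))) t := by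
    intro t ht
    have h1 : HasDerivAt (fun t : ℝ => 2 * t - 1) 2 t := by
      simpa using ((hasDerivAt_id t).const_mul 2).sub_const 1
    have h2 := ((Real.hasDerivAt_arcsin (x := 2 * t - 1) (by linarith [ht.1])
      (by linarith [ht.2])).comp t h1).div_const (√2)
    refine h2.congr_deriv ?_
    have h3 : 1 - (2 * t - 1) ^ 2 = 2 ^ 2 * (t * (1 - t)) := by ring
    rw [h3, Real.sqrt_mul (by positivity), Real.sqrt_sq (by positivity),
      Real.sqrt_mul zero_le_two (t * (1 - t))]
    generalize √(t * (1 - t)) = R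
    field_simp
  refine (intervalIntegral.integrableOn_deriv_of_nonneg
    (g := fun t : ℝ => Real.arcsin (2 * t - 1) / √2) ?_ hd
    (fun t _ => by positivity)).mono_set Ioo_subset_Ioc_self
  exact ((Real.continuous_arcsin.comp (by fun_prop)).div_const _).continuousOn

lemma integrableOn_abel {φ : ℝ → ℝ} {c e : ℝ} (he : 0 < e)
    (hmono : MonotoneOn (fun E => φ E + c * √E) (Ioc 0 e)) (hφ : ∀ E ∈ Ioc 0 e, 0 ≤ φ E) :
    IntegrableOn (fun t => φ (e * t) * (1 / √(2 * (t * (1 - t))))) (Ioo 0 1) := by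
  have hmem : ∀ t ∈ Ioo (0 : ℝ) 1, e * t ∈ Ioc 0 e := fun t ht =>
    ⟨mul_pos he ht.1, by nlinarith [ht.2]⟩
  have hm1 : MonotoneOn (fun t => φ (e * t) + c * √(e * t)) (Ioo 0 1) := fun s hs t ht hst =>
    hmono (hmem s hs) (hmem t ht) (mul_le_mul_of_nonneg_left hst he.le)
  have hmeas : AEMeasurable (fun t => φ (e * t)) (volume.restrict (Ioo 0 1)) := by
    have h1 := (aemeasurable_restrict_of_monotoneOn (μ := volume) measurableSet_Ioo hm1).sub
      (show Measurable fun t : ℝ => c * √(e * t) by fun_prop).aemeasurable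
    refine h1.congr (Filter.Eventually.of_forall fun t => ?_)
    simp
  refine Integrable.bdd_mul (c := φ e + c * √e + |c| * √e) integrableOn_arcsine_density
    hmeas.aestronglyMeasurable ?_
  refine (ae_restrict_iff' measurableSet_Ioo).2 (Filter.Eventually.of_forall fun t ht => ?_)
  have h1 := hmem t ht
  rw [Real.norm_of_nonneg (hφ _ h1)]
  have h2 : φ (e * t) + c * √(e * t) ≤ φ e + c * √e := hmono h1 ⟨he, le_rfl⟩ h1.2
  have h3 : √(e * t) ≤ √e := Real.sqrt_le_sqrt h1.2
  have h4 : -(c * √(e * t)) ≤ |c| * √e := by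
    calc -(c * √(e * t)) ≤ |c| * √(e * t) := by
          nlinarith [neg_abs_le c, Real.sqrt_nonneg (e * t)]
      _ ≤ _ := by gcongr
  linarith

/-- The substitution `t = pot m s / e` on one branch of the well. -/
lemma pot_integral_subst {m e : ℝ} (hm : 0 < m) (hm1 : m < 1) (he : 0 < e) {I : Set ℝ}
    (hI : MeasurableSet I) (hI0 : ∀ s ∈ I, 0 < s ∧ s ≠ 1) (hinj : InjOn (pot m) I)
    (himg : pot m '' I = Ioo 0 e) {φ : ℝ → ℝ}
    (hφ : ∀ s ∈ I, φ (pot m s) = √(pot m s) / |potDeriv m s|) :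
    (∫ s in I, 1 / √(2 * (e - pot m s)) =
      ∫ t in Ioo 0 1, φ (e * t) * (1 / √(2 * (t * (1 - t))))) ∧
    (IntegrableOn (fun t => φ (e * t) * (1 / √(2 * (t * (1 - t))))) (Ioo 0 1) →
      IntegrableOn (fun s => 1 / √(2 * (e - pot m s))) I) := by
  have hd : ∀ s ∈ I, HasDerivWithinAt (fun s => pot m s / e) (potDeriv m s / e) I s :=
    fun s hs => ((hasDerivAt_pot hm (hI0 s hs).1).div_const e).hasDerivWithinAt
  have hinj' : InjOn (fun s => pot m s / e) I := fun s hs t ht h =>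
    hinj hs ht ((div_left_inj' he.ne').1 h)
  have himg' : (fun s => pot m s / e) '' I = Ioo 0 1 := by
    rw [← image_image (fun x => x / e) (pot m), himg]
    ext t
    simp only [mem_image, mem_Ioo]
    constructor
    · rintro ⟨x, hx, rfl⟩
      exact ⟨div_pos hx.1 he, (div_lt_one he).2 hx.2⟩
    · rintro ht
      exact ⟨t * e, ⟨mul_pos ht.1 he, by nlinarith⟩, by field_simp⟩
  have hcongr : EqOn (fun s => |potDeriv m s / e| • (fun t => φ (e * t) *
      (1 / √(2 * (t * (1 - t))))) (pot m s / e)) (fun s => 1 / √(2 * (e - pot m s))) I := by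
    intro s hs
    have hW := pot_pos hm hm1 (hI0 s hs).1 (hI0 s hs).2
    have hV := abs_pos.2 (potDeriv_ne_zero hm1 (hI0 s hs).1 (hI0 s hs).2)
    have hWe : pot m s < e := (himg ▸ mem_image_of_mem _ hs : pot m s ∈ Ioo 0 e).2
    have h1 : e * (pot m s / e) = pot m s := by field_simp
    have h2 : 2 * (pot m s / e * (1 - pot m s / e)) =
        pot m s * (2 * (e - pot m s)) / e ^ 2 := by field_simp
    simp only [smul_eq_mul, h1, h2, hφ s hs]
    rw [Real.sqrt_div' _ (by positivity), Real.sqrt_sq he.le, Real.sqrt_mul hW.le, abs_div,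
      abs_of_pos he]
    have := Real.sqrt_pos.2 hW
    have : 0 < √(2 * (e - pot m s)) := Real.sqrt_pos.2 (by linarith)
    field_simp
  constructor
  · rw [← himg', integral_image_eq_integral_abs_deriv_smul hI hd hinj']
    exact (setIntegral_congr_fun hI hcongr).symm
  · intro h
    rw [← himg', integrableOn_image_iff_integrableOn_abs_deriv_smul hI hd hinj'] at h
    exact h.congr_fun hcongr hI

lemma InjOn.exists_factor {f : ℝ → ℝ} {J : Set ℝ} (hf : InjOn f J) (g : ℝ → ℝ) :
    ∃ φ : ℝ → ℝ, ∀ s ∈ J, φ (f s) = g s :=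
  ⟨fun E => g (Function.invFunOn f J E), fun _ hs => congrArg g (hf.leftInvOn_invFunOn hs)⟩

lemma continuousOn_pot {m : ℝ} (hm : 0 < m) : ContinuousOn (pot m) (Ioi 0) :=
  fun _ hs => (hasDerivAt_pot hm hs).continuousAt.continuousWithinAt

lemma image_pot_right {m y : ℝ} (hm : 0 < m) (hm1 : m < 1) (hy : 1 < y) :
    pot m '' Ioo 1 y = Ioo 0 (pot m y) := by
  apply Subset.antisymm
  · rintro _ ⟨s, hs, rfl⟩
    exact ⟨pot_pos hm hm1 (one_pos.trans hs.1) hs.1.ne',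
      pot_strictMonoOn hm hm1 hs.1.le hy.le hs.2⟩
  · have := intermediate_value_Ioo hy.le ((continuousOn_pot hm).mono
      fun _ (hs : _ ∈ Icc 1 y) => one_pos.trans_le hs.1)
    rwa [pot_one] at this

lemma image_pot_left {m x : ℝ} (hm : 0 < m) (hm1 : m < 1) (hx0 : 0 < x) (hx : x < 1) :
    pot m '' Ioo x 1 = Ioo 0 (pot m x) := by
  apply Subset.antisymm
  · rintro _ ⟨s, hs, rfl⟩
    exact ⟨pot_pos hm hm1 (hx0.trans hs.1) hs.2.ne,
      pot_strictAntiOn hm hm1 ⟨hx0, hx.le⟩ ⟨hx0.trans hs.1, hs.2.le⟩ hs.1⟩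
  · have := intermediate_value_Ioo' hx.le ((continuousOn_pot hm).mono
      fun s (hs : s ∈ Icc x 1) => hx0.trans_le hs.1)
    rwa [pot_one] at this

lemma exists_profile_right {m y : ℝ} (hm : 0 < m) (hm1 : m < 1) (hy : 1 < y) :
    ∃ φ : ℝ → ℝ, (∀ s ∈ Ioc 1 y, φ (pot m s) = √(pot m s) / |potDeriv m s|) ∧
      (∀ E ∈ Ioc 0 (pot m y), 0 ≤ φ E) ∧
      StrictMonoOn (fun E => φ E + m / (3 * (1 - m)) * √E) (Ioc 0 (pot m y)) := by
  have hmono : StrictMonoOn (pot m) (Ioc 1 y) :=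
    (pot_strictMonoOn hm hm1).mono fun _ hs => hs.1.le
  have himg : Ioc 0 (pot m y) ⊆ pot m '' Ioc 1 y := by
    intro E hE
    rcases hE.2.eq_or_lt with rfl | h
    · exact ⟨y, ⟨hy, le_rfl⟩, rfl⟩
    · exact image_mono Ioo_subset_Ioc_self
        ((image_pot_right hm hm1 hy).symm ▸ (⟨hE.1, h⟩ : E ∈ Ioo 0 (pot m y)))
  obtain ⟨φ, hφ⟩ := InjOn.exists_factor hmono.injOn fun s => √(pot m s) / |potDeriv m s|
  refine ⟨φ, hφ, fun E hE => ?_, fun E hE E' hE' hlt => ?_⟩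
  · obtain ⟨s, hs, rfl⟩ := himg hE
    rw [hφ s hs]
    positivity
  · obtain ⟨s, hs, rfl⟩ := himg hE
    obtain ⟨s', hs', rfl⟩ := himg hE'
    have key : ∀ s ∈ Ioc 1 y, φ (pot m s) + m / (3 * (1 - m)) * √(pot m s) = auxA m s := by
      intro s hs
      rw [hφ s hs, abs_of_pos (potDeriv_pos hm1 hs.1), auxA]
      ring
    simp only [key s hs, key s' hs']
    exact auxA_strictMonoOn_Ioi hm hm1 hs.1 hs'.1 ((hmono.lt_iff_lt hs hs').1 hlt)

lemma exists_profile_left {m x : ℝ} (hm : 0 < m) (hm1 : m < 1) (hx0 : 0 < x) (hx : x < 1) :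
    ∃ φ : ℝ → ℝ, (∀ s ∈ Ico x 1, φ (pot m s) = √(pot m s) / |potDeriv m s|) ∧
      (∀ E ∈ Ioc 0 (pot m x), 0 ≤ φ E) ∧
      StrictMonoOn (fun E => φ E + -(m / (3 * (1 - m))) * √E) (Ioc 0 (pot m x)) := by
  have hanti : StrictAntiOn (pot m) (Ico x 1) :=
    (pot_strictAntiOn hm hm1).mono fun s hs => ⟨hx0.trans_le hs.1, hs.2.le⟩
  have himg : Ioc 0 (pot m x) ⊆ pot m '' Ico x 1 := by
    intro E hE
    rcases hE.2.eq_or_lt with rfl | h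
    · exact ⟨x, ⟨le_rfl, hx⟩, rfl⟩
    · exact image_mono Ioo_subset_Ico_self
        ((image_pot_left hm hm1 hx0 hx).symm ▸ (⟨hE.1, h⟩ : E ∈ Ioo 0 (pot m x)))
  obtain ⟨φ, hφ⟩ := InjOn.exists_factor hanti.injOn fun s => √(pot m s) / |potDeriv m s|
  refine ⟨φ, hφ, fun E hE => ?_, fun E hE E' hE' hlt => ?_⟩
  · obtain ⟨s, hs, rfl⟩ := himg hE
    rw [hφ s hs]
    positivity
  · obtain ⟨s, hs, rfl⟩ := himg hE
    obtain ⟨s', hs', rfl⟩ := himg hE'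
    have key : ∀ s ∈ Ico x 1,
        φ (pot m s) + -(m / (3 * (1 - m))) * √(pot m s) = -auxA m s := by
      intro s hs
      rw [hφ s hs, abs_of_neg (potDeriv_neg hm1 (hx0.trans_le hs.1) hs.2), auxA]
      simp only [div_neg, one_div]
      ring
    simp only [key s hs, key s' hs']
    exact neg_lt_neg (auxA_strictMonoOn_Ioo hm hm1 ⟨hx0.trans_le hs'.1, hs'.2⟩
      ⟨hx0.trans_le hs.1, hs.2⟩ ((hanti.lt_iff_gt hs hs').1 hlt))

lemma pot_eq_bounds {m x y : ℝ} (hm : 0 < m) (hm1 : m < 1) (hx0 : 0 < x) (hxy : x < y)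
    (h : pot m x = pot m y) : x < 1 ∧ 1 < y := by
  constructor
  · by_contra! hx
    exact (pot_strictMonoOn hm hm1 hx (hx.trans hxy.le) hxy).ne h
  · by_contra! hy
    exact (pot_strictAntiOn hm hm1 ⟨hx0, hxy.le.trans hy⟩ ⟨hx0.trans hxy, hy⟩ hxy).ne' h

/-- The period of the oscillation in the well of `pot m` is a strictly increasing function of
the energy. -/
theorem pot_integral_strictMono {m x₁ y₁ x₂ y₂ e₁ e₂ : ℝ} (hm : 0 < m) (hm1 : m < 1)
    (hx₁ : 0 < x₁) (hxy₁ : x₁ < y₁) (hx₂ : 0 < x₂) (hxy₂ : x₂ < y₂)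
    (hex₁ : pot m x₁ = e₁) (hey₁ : pot m y₁ = e₁) (hex₂ : pot m x₂ = e₂) (hey₂ : pot m y₂ = e₂)
    (he : e₁ < e₂) :
    ∫ s in x₁..y₁, 1 / √(2 * (e₁ - pot m s)) < ∫ s in x₂..y₂, 1 / √(2 * (e₂ - pot m s)) := by
  obtain ⟨hx₁', hy₁'⟩ := pot_eq_bounds hm hm1 hx₁ hxy₁ (hex₁.trans hey₁.symm)
  obtain ⟨hx₂', hy₂'⟩ := pot_eq_bounds hm hm1 hx₂ hxy₂ (hex₂.trans hey₂.symm)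
  have he₁ : 0 < e₁ := hex₁ ▸ pot_pos hm hm1 hx₁ hx₁'.ne
  obtain ⟨φ, hφ, hφ0, hφm⟩ := exists_profile_right hm hm1 hy₂'
  obtain ⟨χ, hχ, hχ0, hχm⟩ := exists_profile_left hm hm1 hx₂ hx₂'
  rw [hey₂] at hφ0 hφm
  rw [hex₂] at hχ0 hχm
  have main : ∀ x y e : ℝ, 0 < x → x < 1 → 1 < y → pot m x = e → pot m y = e → 0 < e → e ≤ e₂ →
      ∫ s in x..y, 1 / √(2 * (e - pot m s)) =
        ∫ t in Ioo 0 1, (χ (e * t) + φ (e * t)) * (1 / √(2 * (t * (1 - t)))) ∧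
      IntegrableOn (fun t => (χ (e * t) + φ (e * t)) * (1 / √(2 * (t * (1 - t))))) (Ioo 0 1) := by
    intro x y e hx0 hx hy hxe hye he hee
    have hyy : y ≤ y₂ := (pot_strictMonoOn hm hm1).le_iff_le hy.le hy₂'.le |>.1
      (by rw [hye, hey₂]; exact hee)
    have hxx : x₂ ≤ x := (pot_strictAntiOn hm hm1).le_iff_ge ⟨hx0, hx.le⟩ ⟨hx₂, hx₂'.le⟩ |>.1
      (by rw [hxe, hex₂]; exact hee)
    have hIoc : Ioc 0 e ⊆ Ioc 0 e₂ := Ioc_subset_Ioc_right hee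
    have iφ := integrableOn_abel he (hφm.monotoneOn.mono hIoc) fun E hE => hφ0 E (hIoc hE)
    have iχ := integrableOn_abel he (hχm.monotoneOn.mono hIoc) fun E hE => hχ0 E (hIoc hE)
    obtain ⟨r1, r2⟩ := pot_integral_subst hm hm1 he measurableSet_Ioo
      (fun s (hs : s ∈ Ioo 1 y) => ⟨one_pos.trans hs.1, hs.1.ne'⟩)
      ((pot_strictMonoOn hm hm1).injOn.mono fun s hs => hs.1.le)
      (hye ▸ image_pot_right hm hm1 hy)
      (fun s (hs : s ∈ Ioo 1 y) => hφ s ⟨hs.1, hs.2.le.trans hyy⟩)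
    obtain ⟨l1, l2⟩ := pot_integral_subst hm hm1 he measurableSet_Ioo
      (fun s (hs : s ∈ Ioo x 1) => ⟨hx0.trans hs.1, hs.2.ne⟩)
      ((pot_strictAntiOn hm hm1).injOn.mono (show Ioo x 1 ⊆ Ioc 0 1 from fun s hs =>
        ⟨hx0.trans hs.1, hs.2.le⟩))
      (hxe ▸ image_pot_left hm hm1 hx0 hx)
      (fun s (hs : s ∈ Ioo x 1) => hχ s ⟨hxx.trans hs.1.le, hs.2⟩)
    have hsum : ∀ t, (χ (e * t) + φ (e * t)) * (1 / √(2 * (t * (1 - t)))) =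
        χ (e * t) * (1 / √(2 * (t * (1 - t)))) + φ (e * t) * (1 / √(2 * (t * (1 - t)))) :=
      fun t => add_mul _ _ _
    simp only [hsum]
    refine ⟨?_, iχ.add iφ⟩
    rw [integral_add iχ iφ, ← l1, ← r1, ← intervalIntegral.integral_add_adjacent_intervals
      ((intervalIntegrable_iff_integrableOn_Ioo_of_le hx.le).2 (l2 iχ))
      ((intervalIntegrable_iff_integrableOn_Ioo_of_le hy.le).2 (r2 iφ)),
      intervalIntegral.integral_of_le hx.le, intervalIntegral.integral_of_le hy.le,
      integral_Ioc_eq_integral_Ioo, integral_Ioc_eq_integral_Ioo]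
  obtain ⟨q₁, i₁⟩ := main x₁ y₁ e₁ hx₁ hx₁' hy₁' hex₁ hey₁ he₁ he.le
  obtain ⟨q₂, i₂⟩ := main x₂ y₂ e₂ hx₂ hx₂' hy₂' hex₂ hey₂ (he₁.trans he) le_rfl
  rw [q₁, q₂, ← sub_pos, ← integral_sub i₂ i₁]
  have hpos : ∀ t ∈ Ioo (0 : ℝ) 1,
      0 < (χ (e₂ * t) + φ (e₂ * t)) * (1 / √(2 * (t * (1 - t)))) -
        (χ (e₁ * t) + φ (e₁ * t)) * (1 / √(2 * (t * (1 - t)))) := by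
    intro t ht
    have h1 : e₁ * t ∈ Ioc 0 e₂ := ⟨mul_pos he₁ ht.1, by nlinarith [ht.1, ht.2]⟩
    have h2 : e₂ * t ∈ Ioc 0 e₂ := ⟨mul_pos (he₁.trans he) ht.1, by nlinarith [ht.1, ht.2]⟩
    have h3 : e₁ * t < e₂ * t := mul_lt_mul_of_pos_right he ht.1
    have h4 := hφm h1 h2 h3
    have h5 := hχm h1 h2 h3
    simp only at h4 h5
    have h6 : 0 < t * (1 - t) := mul_pos ht.1 (by linarith [ht.2])
    rw [← sub_mul]
    exact mul_pos (by linarith) (by positivity)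
  rw [setIntegral_pos_iff_support_of_nonneg_ae
    ((ae_restrict_iff' measurableSet_Ioo).2 (Filter.Eventually.of_forall fun t ht =>
      (hpos t ht).le)) (i₂.sub i₁)]
  rw [inter_eq_right.2 (fun t ht => Function.mem_support.2 (hpos t ht).ne')]
  simp

/-- The change of variables `r = c * s ^ (-k)` turns the apsidal angle into a period. -/
lemma apsidalAngle_eq_pot_integral {α ℓ h c k e m x y : ℝ} (hℓ : 0 < ℓ) (hc : 0 < c)
    (hk : 0 < k) (hx : 0 < x) (hxy : x < y)
    (hid : ∀ s, 0 < s → 2 * (h + (c * s ^ (-k)) ^ (-α) / α) - ℓ ^ 2 / (c * s ^ (-k)) ^ 2 =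
      (ℓ * (s ^ k / s) / c) ^ 2 * (2 * (e - pot m s))) :
    apsidalAngle α ℓ h (c * y ^ (-k)) (c * x ^ (-k)) =
      k * ∫ s in x..y, 1 / √(2 * (e - pot m s)) := by
  have hpos : ∀ s ∈ Ioo x y, 0 < s := fun s hs => hx.trans hs.1
  have hd : ∀ s ∈ Ioo x y, HasDerivWithinAt (fun s => c * s ^ (-k))
      (c * (-k * (s ^ (-k) / s))) (Ioo x y) s := fun s hs =>
    ((hasDerivAt_rpow_div (hpos s hs)).const_mul c).hasDerivWithinAt
  have hlt : ∀ s t : ℝ, 0 < s → s < t → c * t ^ (-k) < c * s ^ (-k) := fun s t hs hst =>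
    mul_lt_mul_of_pos_left (Real.rpow_lt_rpow_of_neg hs hst (neg_neg_of_pos hk)) hc
  have hanti : StrictAntiOn (fun s => c * s ^ (-k)) (Ioi 0) := fun s hs t _ hst => hlt s t hs hst
  have himg : (fun s => c * s ^ (-k)) '' Ioo x y = Ioo (c * y ^ (-k)) (c * x ^ (-k)) := by
    apply Subset.antisymm
    · rintro _ ⟨s, hs, rfl⟩
      exact ⟨hlt s y (hpos s hs) hs.2, hlt x s hx hs.1⟩
    · refine intermediate_value_Ioo' (f := fun s => c * s ^ (-k)) hxy.le fun s hs => ?_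
      exact ((hasDerivAt_rpow_div (hx.trans_le hs.1)).const_mul
        c).continuousAt.continuousWithinAt
  rw [apsidalAngle, intervalIntegral.integral_of_le (hlt x y hx hxy).le,
    integral_Ioc_eq_integral_Ioo, ← himg, integral_image_eq_integral_abs_deriv_smul
      measurableSet_Ioo hd (hanti.injOn.mono hpos), intervalIntegral.integral_of_le hxy.le,
    integral_Ioc_eq_integral_Ioo, ← integral_const_mul]
  refine setIntegral_congr_fun measurableSet_Ioo fun s hs => ?_
  have hs0 := hpos s hs
  have hsk := Real.rpow_pos_of_pos hs0 k
  simp only [smul_eq_mul]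
  rw [hid s hs0, Real.sqrt_mul (by positivity), Real.sqrt_sq (by positivity),
    Real.rpow_neg hs0.le, show c * (-k * ((s ^ k)⁻¹ / s)) = -(c * (k * ((s ^ k)⁻¹ / s))) by ring,
    abs_neg, abs_of_pos (by positivity)]
  generalize √(2 * (e - pot m s)) = R
  field_simp

lemma rpow_substitution {c k a : ℝ} (hc : 0 < c) (hk : 0 < k) (ha : 0 < a) :
    c * ((a / c) ^ (-(1 / k))) ^ (-k) = a := by
  rw [← Real.rpow_mul (by positivity)]
  have : -(1 / k) * -k = 1 := by field_simp
  rw [this, Real.rpow_one]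
  field_simp

/-- An apsidal angle which is conjugate to the motion in the well of `pot m`. -/
lemma exists_apsidalAngle_eq {α ℓ h c k e m a b : ℝ} (hℓ : 0 < ℓ) (hc : 0 < c)
    (hk : 0 < k) (H : IsTwoApsidal α ℓ h a b)
    (hid : ∀ s, 0 < s → 2 * (h + (c * s ^ (-k)) ^ (-α) / α) - ℓ ^ 2 / (c * s ^ (-k)) ^ 2 =
      (ℓ * (s ^ k / s) / c) ^ 2 * (2 * (e - pot m s))) :
    ∃ x y, 0 < x ∧ x < y ∧ pot m x = e ∧ pot m y = e ∧
      apsidalAngle α ℓ h a b = k * ∫ s in x..y, 1 / √(2 * (e - pot m s)) := by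
  obtain ⟨ha, hab, hea, heb, -⟩ := H
  have hb := ha.trans hab
  have hpot : ∀ r, 0 < r → h + r ^ (-α) / α - ℓ ^ 2 / (2 * r ^ 2) = 0 →
      pot m ((r / c) ^ (-(1 / k))) = e := by
    intro r hr her
    have hs : 0 < (r / c) ^ (-(1 / k)) := by positivity
    have h1 := hid _ hs
    rw [rpow_substitution hc hk hr] at h1
    have h2 : 2 * (h + r ^ (-α) / α) - ℓ ^ 2 / r ^ 2 =
        2 * (h + r ^ (-α) / α - ℓ ^ 2 / (2 * r ^ 2)) := by field_simp
    rw [h2, her, mul_zero] at h1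
    set s := (r / c) ^ (-(1 / k))
    have h3 : 0 < (ℓ * (s ^ k / s) / c) ^ 2 := by positivity
    have h4 := (mul_eq_zero.1 h1.symm).resolve_left h3.ne'
    linarith
  have hxy : (b / c) ^ (-(1 / k)) < (a / c) ^ (-(1 / k)) :=
    Real.rpow_lt_rpow_of_neg (by positivity) (by gcongr) (by simpa using hk)
  have := apsidalAngle_eq_pot_integral hℓ hc hk (by positivity) hxy hid
  rw [rpow_substitution hc hk ha, rpow_substitution hc hk hb] at this
  exact ⟨_, _, by positivity, hxy, hpot b hb heb, hpot a ha hea, this⟩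

lemma apsidalAngle_lt_of_conjugate {α ℓ h₁ h₂ c₁ c₂ k e₁ e₂ m a₁ b₁ a₂ b₂ : ℝ}
    (hm : 0 < m) (hm1 : m < 1) (hℓ : 0 < ℓ) (hc₁ : 0 < c₁) (hc₂ : 0 < c₂) (hk : 0 < k)
    (H₁ : IsTwoApsidal α ℓ h₁ a₁ b₁) (H₂ : IsTwoApsidal α ℓ h₂ a₂ b₂) (he : e₁ < e₂)
    (hid₁ : ∀ s, 0 < s → 2 * (h₁ + (c₁ * s ^ (-k)) ^ (-α) / α) - ℓ ^ 2 / (c₁ * s ^ (-k)) ^ 2 =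
      (ℓ * (s ^ k / s) / c₁) ^ 2 * (2 * (e₁ - pot m s)))
    (hid₂ : ∀ s, 0 < s → 2 * (h₂ + (c₂ * s ^ (-k)) ^ (-α) / α) - ℓ ^ 2 / (c₂ * s ^ (-k)) ^ 2 =
      (ℓ * (s ^ k / s) / c₂) ^ 2 * (2 * (e₂ - pot m s))) :
    apsidalAngle α ℓ h₁ a₁ b₁ < apsidalAngle α ℓ h₂ a₂ b₂ := by
  obtain ⟨x₁, y₁, hx₁, hxy₁, hex₁, hey₁, q₁⟩ := exists_apsidalAngle_eq hℓ hc₁ hk H₁ hid₁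
  obtain ⟨x₂, y₂, hx₂, hxy₂, hex₂, hey₂, q₂⟩ := exists_apsidalAngle_eq hℓ hc₂ hk H₂ hid₂
  rw [q₁, q₂]
  exact mul_lt_mul_of_pos_left (pot_integral_strictMono hm hm1 hx₁ hxy₁ hx₂ hxy₂
    hex₁ hey₁ hex₂ hey₂ he) hk

lemma conjugate_of_one_lt {α ℓ h : ℝ} (hℓ : 0 < ℓ) (h1 : 1 < α) (h2 : α < 2) {s : ℝ}
    (hs : 0 < s) {c : ℝ} (hc : c = ℓ ^ (2 / (2 - α))) :
    2 * (h + (c * s ^ (-1 : ℝ)) ^ (-α) / α) - ℓ ^ 2 / (c * s ^ (-1 : ℝ)) ^ 2 =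
      (ℓ * (s ^ (1 : ℝ) / s) / c) ^ 2 *
        (2 * ((h * c ^ 2 / ℓ ^ 2 + (1 / α - 1 / 2)) - pot (α - 1) s)) := by
  have hc0 : 0 < c := hc ▸ Real.rpow_pos_of_pos hℓ _
  have hcα : c ^ (-α) = ℓ ^ 2 / c ^ 2 := by
    rw [eq_div_iff (by positivity), ← Real.rpow_natCast c 2, ← Real.rpow_add hc0, hc,
      ← Real.rpow_mul hℓ.le]
    have : 2 / (2 - α) * (-α + (2 : ℕ)) = (2 : ℕ) := by
      have : 2 - α ≠ 0 := by linarith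
      push_cast
      field_simp
      ring
    rw [this, Real.rpow_natCast]
  have hsα : (s ^ (-1 : ℝ)) ^ (-α) = s * s ^ (α - 1) := by
    rw [← Real.rpow_mul hs.le, Real.rpow_sub_one hs.ne']
    field_simp
  rw [Real.mul_rpow hc0.le (by positivity), hcα, hsα, Real.rpow_neg_one, Real.rpow_one, pot,
    sub_add_cancel]
  field_simp
  ring

/-- The duality between the exponents `α` and `β` with `(2 - α) * (2 - β) = 4`, which exchanges the
roles of the energy and of the coupling constant. -/
lemma conjugate_of_lt_neg_two {α ℓ h : ℝ} (hℓ : 0 < ℓ) (hα : α < -2) (hh : 0 < h) {s : ℝ}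
    (hs : 0 < s) {c k m : ℝ} (hk : k = 2 / (2 - α)) (hm : m = 1 - 2 * k)
    (hc : c = ℓ / √((m + 1) * h)) (hm0 : 0 < m) :
    2 * (h + (c * s ^ (-k)) ^ (-α) / α) - ℓ ^ 2 / (c * s ^ (-k)) ^ 2 =
      (ℓ * (s ^ k / s) / c) ^ 2 *
        (2 * ((c ^ (2 - α) / (α * ℓ ^ 2) + (1 / (m + 1) - 1 / 2)) - pot m s)) := by
  have hc0 : 0 < c := by rw [hc]; positivity
  have hα2 : 2 - α ≠ 0 := by linarith
  have hα0 : α ≠ 0 := by linarith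
  have hc2 : c ^ 2 * h = ℓ ^ 2 / (m + 1) := by
    rw [hc, div_pow, Real.sq_sqrt (by positivity)]
    field_simp
  have hcα : c ^ (2 - α) = c ^ 2 * c ^ (-α) := by
    rw [← Real.rpow_natCast c 2, ← Real.rpow_add hc0]
    push_cast
    ring_nf
  have hsα : (s ^ (-k)) ^ (-α) = (s ^ k / s) ^ 2 := by
    rw [← Real.rpow_sub_one hs.ne', ← Real.rpow_mul hs.le, ← Real.rpow_natCast,
      ← Real.rpow_mul hs.le]
    congr 1
    rw [hk]
    push_cast
    field_simp
    ring
  have hsm : s ^ m = s / (s ^ k) ^ 2 := by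
    rw [hm, Real.rpow_sub hs, Real.rpow_one, mul_comm 2 k, Real.rpow_mul hs.le]
    norm_num
  have hh' : h = ℓ ^ 2 / (m + 1) / c ^ 2 := by
    rw [← hc2]
    field_simp
  have hsk := Real.rpow_pos_of_pos hs k
  rw [Real.mul_rpow hc0.le (by positivity), hsα, Real.rpow_neg hs.le, pot, hsm, hcα, hh']
  generalize s ^ k = Y at *
  generalize c ^ (-α) = C at *
  have : m + 1 ≠ 0 := by linarith
  field_simp
  ring

lemma IsTwoApsidal.energy_pos {α ℓ h a b : ℝ} (hℓ : 0 < ℓ) (hα : α < 0)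
    (H : IsTwoApsidal α ℓ h a b) : 0 < h := by
  obtain ⟨ha, -, hea, -⟩ := H
  have h1 : a ^ (-α) / α < 0 := div_neg_of_pos_of_neg (by positivity) hα
  have h2 : 0 < ℓ ^ 2 / (2 * a ^ 2) := by positivity
  linarith

/-- For `ℓ > 0` and `α ∈ (-∞, -2) ∪ (1, 2)`, the apsidal angle is a strictly
increasing function of the energy on the set of admissible energies. -/
theorem apsidalAngle_strictMono (α ℓ : ℝ) (hℓ : 0 < ℓ)
    (hα : α < -2 ∨ (1 < α ∧ α < 2))
    (h₁ h₂ : ℝ) (hh : h₁ < h₂) (a₁ b₁ a₂ b₂ : ℝ)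
    (H₁ : IsTwoApsidal α ℓ h₁ a₁ b₁) (H₂ : IsTwoApsidal α ℓ h₂ a₂ b₂) :
    apsidalAngle α ℓ h₁ a₁ b₁ < apsidalAngle α ℓ h₂ a₂ b₂ := by
  rcases hα with hα | ⟨hα1, hα2⟩
  · have hα0 : α < 0 := by linarith
    have hp₁ := H₁.energy_pos hℓ hα0
    have hp₂ := H₂.energy_pos hℓ hα0
    have h2α : 0 < 2 - α := by linarith
    have hk : 0 < 2 / (2 - α) := by positivity
    have hk2 : 2 / (2 - α) < 1 / 2 := by
      rw [div_lt_div_iff₀ h2α two_pos]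
      linarith
    obtain ⟨m, hm⟩ : ∃ m, m = 1 - 2 * (2 / (2 - α)) := ⟨_, rfl⟩
    have hm0 : 0 < m := by linarith
    have hm1 : m < 1 := by linarith
    refine apsidalAngle_lt_of_conjugate hm0 hm1 hℓ
      (c₁ := ℓ / √((m + 1) * h₁)) (c₂ := ℓ / √((m + 1) * h₂))
      (by positivity) (by positivity) hk H₁ H₂ ?_
      (fun s hs => conjugate_of_lt_neg_two hℓ hα hp₁ hs rfl hm rfl hm0)
      (fun s hs => conjugate_of_lt_neg_two hℓ hα hp₂ hs rfl hm rfl hm0)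
    refine add_lt_add_left (div_lt_div_of_neg_of_lt
      (mul_neg_of_neg_of_pos hα0 (by positivity)) ?_) _
    refine Real.rpow_lt_rpow (by positivity) ?_ h2α
    gcongr
  · have hc : 0 < ℓ ^ (2 / (2 - α)) := Real.rpow_pos_of_pos hℓ _
    refine apsidalAngle_lt_of_conjugate (m := α - 1) (by linarith) (by linarith) hℓ hc hc one_pos
      H₁ H₂ ?_ (fun s hs => conjugate_of_one_lt hℓ hα1 hα2 hs rfl)
      (fun s hs => conjugate_of_one_lt hℓ hα1 hα2 hs rfl)
    gcongr
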